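/- Let A = P^h Q^k R^l in 𝔽₄[x], where P, Q, R are distinct monic irreducible polynomials with deg P ≤ deg Q ≤ deg R and h, k, l are positive integers that are not all odd. Then A is not bi-unitary perfect. -/

import Mathlib

open Polynomial
open scoped Classical

noncomputable section

/-- The field with four elements. -/
abbrev F4 : Type := GaloisField 2 2

/-- `D` is a unitary divisor of `S`: `D ∣ S` and `gcd(D, S / D) = 1`. -/
def IsUnitaryDivisor (D S : F4[X]) : Prop :=
  D ∣ S ∧ IsCoprime D (S / D)

/-- The greatest common unitary divisor of `S` and `T`: a monic common unitary
divisor of `S` and `T` of maximal degree. -/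
noncomputable def gcdU (S T : F4[X]) : F4[X] :=
  if h : ∃ D : F4[X], D.Monic ∧ IsUnitaryDivisor D S ∧ IsUnitaryDivisor D T ∧
      ∀ E : F4[X], E.Monic → IsUnitaryDivisor E S → IsUnitaryDivisor E T →
        E.degree ≤ D.degree
  then h.choose else 0

/-- `D` is a bi-unitary divisor of `S`: `D ∣ S` and `gcd_u(D, S / D) = 1`. -/
def IsBiunitaryDivisor (D S : F4[X]) : Prop :=
  D ∣ S ∧ gcdU D (S / D) = 1

/-- `σ(S)`: the sum of all monic divisors of `S`. -/
noncomputable def sigma' (S : F4[X]) : F4[X] :=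
  ∑ᶠ D ∈ {D : F4[X] | D.Monic ∧ D ∣ S}, D

/-- `σ**(S)`: the sum of all monic bi-unitary divisors of `S`. -/
noncomputable def sigmaBU (S : F4[X]) : F4[X] :=
  ∑ᶠ D ∈ {D : F4[X] | D.Monic ∧ IsBiunitaryDivisor D S}, D

/-- `S` is perfect if `σ(S) = S`. -/
def IsPerfect (S : F4[X]) : Prop := sigma' S = S

/-- `S` is bi-unitary perfect if `σ**(S) = S`. -/
def IsBUPerfect (S : F4[X]) : Prop := sigmaBU S = S

/-- `ω(S)`: the number of distinct monic irreducible factors of `S`. -/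
noncomputable def omegaCount (S : F4[X]) : ℕ :=
  Set.ncard {P : F4[X] | P.Monic ∧ Irreducible P ∧ P ∣ S}

/-- `Ω₁`: `P` and `P + 1` are both irreducible. -/
def Omega1 (P : F4[X]) : Prop :=
  Irreducible P ∧ Irreducible (P + 1)

/-- `Ω₂`: `P`, `P + 1`, `P³ + P + 1` and `P³ + P² + 1` are all irreducible. -/
def Omega2 (P : F4[X]) : Prop :=
  Irreducible P ∧ Irreducible (P + 1) ∧
    Irreducible (P ^ 3 + P + 1) ∧ Irreducible (P ^ 3 + P ^ 2 + 1)

/-- A bi-unitary perfect polynomial is indecomposable if it has no proper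
(monic, nontrivial) divisor which is bi-unitary perfect. -/
def IsIndecomposable (A : F4[X]) : Prop :=
  ¬ ∃ D : F4[X], D.Monic ∧ D ∣ A ∧ D ≠ 1 ∧ D ≠ A ∧ IsBUPerfect D

/-! ### Bi-unitary divisors -/

lemma gcdU_eq_one_iff (S T : F4[X]) : gcdU S T = 1 ↔
    ∀ E : F4[X], E.Monic → IsUnitaryDivisor E S → IsUnitaryDivisor E T → E = 1 := by
  constructor
  · intro hg E hE h1 h2
    unfold gcdU at hg
    split_ifs at hg with hex
    · have hs := hex.choose_spec.2.2.2 E hE h1 h2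
      rw [hg, degree_one] at hs
      exact hE.degree_le_zero_iff_eq_one.mp hs
    · exact absurd hg zero_ne_one
  · intro hall
    have hex : ∃ D : F4[X], D.Monic ∧ IsUnitaryDivisor D S ∧ IsUnitaryDivisor D T ∧
      ∀ E : F4[X], E.Monic → IsUnitaryDivisor E S → IsUnitaryDivisor E T →
        E.degree ≤ D.degree := by
      refine ⟨1, monic_one, ⟨one_dvd _, isCoprime_one_left⟩, ⟨one_dvd _, isCoprime_one_left⟩, ?_⟩
      intro E hE h1 h2
      rw [hall E hE h1 h2]
    unfold gcdU
    rw [dif_pos hex]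
    exact hall _ hex.choose_spec.1 hex.choose_spec.2.1 hex.choose_spec.2.2.1

lemma isUnitary_mul {D E : F4[X]} (hD : D ≠ 0) (hc : IsCoprime D E) :
    IsUnitaryDivisor D (D * E) := by
  refine ⟨dvd_mul_right _ _, ?_⟩
  rwa [mul_div_cancel_left₀ _ hD]

/-- If an irreducible `P` divides a unitary divisor `D` of `S`, then every power of `P`
dividing `S` divides `D`. -/
lemma pow_dvd_of_unitary {P D S : F4[X]} (hP : Irreducible P) (hD : IsUnitaryDivisor D S)
    (hPD : P ∣ D) {a : ℕ} (ha : P ^ a ∣ S) : P ^ a ∣ D := by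
  have hc : IsCoprime (P ^ a) (S / D) := (IsCoprime.of_isCoprime_of_dvd_left hD.2 hPD).pow_left
  have : D * (S / D) = S := EuclideanDomain.mul_div_cancel' (by
    rintro rfl
    have := hD.2
    have h0 := hD.1
    rw [zero_dvd_iff] at h0
    subst h0
    exact not_isCoprime_zero_zero (R := F4[X]) (by simpa using this)) hD.1
  rw [← this] at ha
  exact hc.dvd_of_dvd_mul_right ha

lemma coprime_of_ne {P Q : F4[X]} (hPm : P.Monic) (hQm : Q.Monic)
    (hPi : Irreducible P) (hQi : Irreducible Q) (hPQ : P ≠ Q) : IsCoprime P Q := by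
  rw [hPi.coprime_iff_not_dvd]
  intro hd
  exact hPQ (eq_of_monic_of_associated hPm hQm (hPi.associated_of_dvd hQi hd))

/-- A triple of pairwise coprime monic irreducibles. -/
structure Triple (P Q R : F4[X]) : Prop where
  Pm : P.Monic
  Qm : Q.Monic
  Rm : R.Monic
  Pi : Irreducible P
  Qi : Irreducible Q
  Ri : Irreducible R
  PQ : P ≠ Q
  PR : P ≠ R
  QR : Q ≠ R

lemma Triple.rot {P Q R : F4[X]} (t : Triple P Q R) : Triple Q R P :=
  ⟨t.Qm, t.Rm, t.Pm, t.Qi, t.Ri, t.Pi, t.QR, t.PQ.symm, t.PR.symm⟩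

lemma Triple.cop {P Q R : F4[X]} (t : Triple P Q R) (b c : ℕ) : IsCoprime P (Q ^ b * R ^ c) :=
  IsCoprime.mul_right (coprime_of_ne t.Pm t.Qm t.Pi t.Qi t.PQ).pow_right
    (coprime_of_ne t.Pm t.Rm t.Pi t.Ri t.PR).pow_right

lemma Triple.le_of_dvd {P Q R : F4[X]} (t : Triple P Q R) {a a' b c : ℕ}
    (hd : P ^ a ∣ P ^ a' * (Q ^ b * R ^ c)) : a ≤ a' := by
  have h1 : P ^ a ∣ P ^ a' := (t.cop b c).pow_left.dvd_of_dvd_mul_right hd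
  exact (pow_dvd_pow_iff t.Pi.ne_zero t.Pi.not_isUnit).mp h1

lemma rot_mul (A B C : F4[X]) : A * (B * C) = B * (C * A) := by ring

lemma Triple.le_all {P Q R : F4[X]} (t : Triple P Q R) {a a' b b' c c' : ℕ}
    (hd : P ^ a * (Q ^ b * R ^ c) ∣ P ^ a' * (Q ^ b' * R ^ c')) : a ≤ a' ∧ b ≤ b' ∧ c ≤ c' := by
  refine ⟨t.le_of_dvd (dvd_trans (dvd_mul_right _ _) hd), ?_, ?_⟩
  · rw [rot_mul (P ^ a), rot_mul (P ^ a')] at hd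
    exact t.rot.le_of_dvd (dvd_trans (dvd_mul_right _ _) hd)
  · rw [← rot_mul (R ^ c), ← rot_mul (R ^ c')] at hd
    exact t.rot.rot.le_of_dvd (dvd_trans (dvd_mul_right _ _) hd)

lemma Triple.irr_dvd {P Q R p : F4[X]} (t : Triple P Q R) {a b c : ℕ} (hp : Irreducible p)
    (hpm : p.Monic) (hd : p ∣ P ^ a * (Q ^ b * R ^ c)) : p = P ∨ p = Q ∨ p = R := by
  have key : ∀ {q : F4[X]} {n : ℕ}, q.Monic → Irreducible q → p ∣ q ^ n → p = q := by
    intro q n hqm hq hd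
    exact eq_of_monic_of_associated hpm hqm (hp.associated_of_dvd hq (hp.prime.dvd_of_dvd_pow hd))
  rcases hp.prime.dvd_or_dvd hd with h1 | h1
  · exact Or.inl (key t.Pm t.Pi h1)
  · rcases hp.prime.dvd_or_dvd h1 with h2 | h2
    · exact Or.inr (Or.inl (key t.Qm t.Qi h2))
    · exact Or.inr (Or.inr (key t.Rm t.Ri h2))

lemma Triple.exists_of_dvd {P Q R D : F4[X]} (t : Triple P Q R) {h k l : ℕ} (hD : D.Monic)
    (hd : D ∣ P ^ h * (Q ^ k * R ^ l)) :
    ∃ a b c, a ≤ h ∧ b ≤ k ∧ c ≤ l ∧ D = P ^ a * (Q ^ b * R ^ c) := by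
  obtain ⟨D1, D', h1, h', rfl⟩ := exists_dvd_and_dvd_of_dvd_mul hd
  obtain ⟨D2, D3, h2, h3, rfl⟩ := exists_dvd_and_dvd_of_dvd_mul h'
  obtain ⟨a, ha, hA⟩ := (dvd_prime_pow t.Pi.prime _).mp h1
  obtain ⟨b, hb, hB⟩ := (dvd_prime_pow t.Qi.prime _).mp h2
  obtain ⟨c, hc, hC⟩ := (dvd_prime_pow t.Ri.prime _).mp h3
  refine ⟨a, b, c, ha, hb, hc, eq_of_monic_of_associated hD ?_ (hA.mul_mul (hB.mul_mul hC))⟩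
  exact (t.Pm.pow a).mul ((t.Qm.pow b).mul (t.Rm.pow c))

lemma Triple.bi_forward {P Q R : F4[X]} (t : Triple P Q R) {h b b' c c' a : ℕ} (hh : 0 < h)
    (hg : gcdU (P ^ a * (Q ^ b * R ^ c)) (P ^ (h - a) * (Q ^ b' * R ^ c')) = 1) : 2 * a ≠ h := by
  intro h2
  have e : h - a = a := by omega
  rw [e, gcdU_eq_one_iff] at hg
  have := hg (P ^ a) (t.Pm.pow a)
    (isUnitary_mul (pow_ne_zero _ t.Pi.ne_zero) (t.cop _ _).pow_left)
    (isUnitary_mul (pow_ne_zero _ t.Pi.ne_zero) (t.cop _ _).pow_left)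
  have hu : IsUnit (P ^ a) := by rw [this]; exact isUnit_one
  rw [isUnit_pow_iff (by omega)] at hu
  exact t.Pi.not_isUnit hu

lemma Triple.eq_of_unitary {P Q R E : F4[X]} (t : Triple P Q R) {a a' b b' c c' : ℕ}
    (h1 : IsUnitaryDivisor E (P ^ a * (Q ^ b * R ^ c)))
    (h2 : IsUnitaryDivisor E (P ^ a' * (Q ^ b' * R ^ c'))) (hPE : P ∣ E) : a = a' := by
  apply le_antisymm
  · exact t.le_of_dvd ((pow_dvd_of_unitary t.Pi h1 hPE (dvd_mul_right _ _)).trans h2.1)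
  · exact t.le_of_dvd ((pow_dvd_of_unitary t.Pi h2 hPE (dvd_mul_right _ _)).trans h1.1)

lemma Triple.bi_iff {P Q R : F4[X]} (t : Triple P Q R) {h k l a b c : ℕ} (hh : 0 < h)
    (hk : 0 < k) (hl : 0 < l) (ha : a ≤ h) (hb : b ≤ k) (hc : c ≤ l) :
    IsBiunitaryDivisor (P ^ a * (Q ^ b * R ^ c)) (P ^ h * (Q ^ k * R ^ l)) ↔
      2 * a ≠ h ∧ 2 * b ≠ k ∧ 2 * c ≠ l := by
  have hne : P ^ a * (Q ^ b * R ^ c) ≠ 0 :=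
    ((t.Pm.pow a).mul ((t.Qm.pow b).mul (t.Rm.pow c))).ne_zero
  have hfac : P ^ h * (Q ^ k * R ^ l) =
      (P ^ a * (Q ^ b * R ^ c)) * (P ^ (h - a) * (Q ^ (k - b) * R ^ (l - c))) := by
    conv_lhs => rw [← Nat.add_sub_cancel' ha, ← Nat.add_sub_cancel' hb, ← Nat.add_sub_cancel' hc]
    rw [pow_add, pow_add, pow_add]
    ring
  unfold IsBiunitaryDivisor
  rw [hfac, mul_div_cancel_left₀ _ hne]
  constructor
  · rintro ⟨-, hg⟩
    refine ⟨t.bi_forward hh hg, ?_, ?_⟩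
    · rw [rot_mul (P ^ a), rot_mul (P ^ (h - a))] at hg
      exact t.rot.bi_forward hk hg
    · rw [← rot_mul (R ^ c), ← rot_mul (R ^ (l - c))] at hg
      exact t.rot.rot.bi_forward hl hg
  · rintro ⟨h1, h2, h3⟩
    refine ⟨dvd_mul_right _ _, ?_⟩
    rw [gcdU_eq_one_iff]
    intro E hE u1 u2
    by_contra hE1
    obtain ⟨p, hpm, hpi, hpE⟩ : ∃ p : F4[X], p.Monic ∧ Irreducible p ∧ p ∣ E := by
      obtain ⟨p, hp1, hp2, hp3⟩ := exists_monic_irreducible_factor E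
        (fun hu => hE1 (hE.eq_one_of_isUnit hu))
      exact ⟨p, by assumption, by assumption, by assumption⟩
    rcases t.irr_dvd hpi hpm (hpE.trans u1.1) with rfl | rfl | rfl
    · have := t.eq_of_unitary u1 u2 hpE
      omega
    · rw [rot_mul] at u1 u2
      have := t.rot.eq_of_unitary u1 u2 hpE
      omega
    · rw [← rot_mul] at u1 u2
      have := t.rot.rot.eq_of_unitary u1 u2 hpE
      omega

/-! ### The sum over prime powers -/

/-- Exponents of the bi-unitary divisors of a prime power. -/
def expo (h : ℕ) : Finset ℕ := (Finset.range (h + 1)).filter (fun a => 2 * a ≠ h)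

/-- `σ**(P^h)`. -/
def sg (P : F4[X]) (h : ℕ) : F4[X] := ∑ a ∈ expo h, P ^ a

lemma mem_expo {h a : ℕ} : a ∈ expo h ↔ a ≤ h ∧ 2 * a ≠ h := by
  simp [expo]

lemma Triple.sigmaBU_eq {P Q R : F4[X]} (t : Triple P Q R) {h k l : ℕ} (hh : 0 < h)
    (hk : 0 < k) (hl : 0 < l) :
    sigmaBU (P ^ h * (Q ^ k * R ^ l)) = sg P h * (sg Q k * sg R l) := by
  have hset : {D : F4[X] | D.Monic ∧ IsBiunitaryDivisor D (P ^ h * (Q ^ k * R ^ l))} =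
      ((expo h ×ˢ (expo k ×ˢ expo l)).image
        (fun x : ℕ × ℕ × ℕ => P ^ x.1 * (Q ^ x.2.1 * R ^ x.2.2)) : Finset F4[X]) := by
    ext D
    simp only [Set.mem_ofPred_eq, Finset.coe_image, Set.mem_image, Finset.mem_coe,
      Finset.mem_product, mem_expo, Prod.exists]
    constructor
    · rintro ⟨hD, hb⟩
      obtain ⟨a, b, c, ha, hb', hc, rfl⟩ := t.exists_of_dvd hD hb.1
      have := (t.bi_iff hh hk hl ha hb' hc).mp hb
      exact ⟨a, b, c, ⟨⟨ha, this.1⟩, ⟨hb', this.2.1⟩, hc, this.2.2⟩, rfl⟩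
    · rintro ⟨a, b, c, ⟨⟨ha, h1⟩, ⟨hb', h2⟩, hc, h3⟩, rfl⟩
      exact ⟨(t.Pm.pow a).mul ((t.Qm.pow b).mul (t.Rm.pow c)),
        (t.bi_iff hh hk hl ha hb' hc).mpr ⟨h1, h2, h3⟩⟩
  unfold sigmaBU
  rw [hset, finsum_mem_coe_finset, Finset.sum_image]
  · unfold sg
    rw [Finset.sum_mul_sum (expo k), Finset.sum_mul, Finset.sum_product]
    refine Finset.sum_congr rfl fun a _ => ?_
    rw [Finset.sum_product]
    simp only [Finset.mul_sum]
  · rintro ⟨a, b, c⟩ - ⟨a', b', c'⟩ - he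
    simp only at he
    have l1 := t.le_all he.dvd
    have l2 := t.le_all he.symm.dvd
    simp only [Prod.mk.injEq]
    omega

/-- `1 + P + ⋯ + P^(n-1)`. -/
def gs (P : F4[X]) (n : ℕ) : F4[X] := ∑ i ∈ Finset.range n, P ^ i

lemma gs_mul (P : F4[X]) (n : ℕ) : gs P n * (P + 1) = P ^ n + 1 := by
  have := geom_sum_mul P n
  rwa [CharTwo.sub_eq_add, CharTwo.sub_eq_add] at this

lemma gs_succ' (P : F4[X]) (n : ℕ) : gs P (n + 1) = P * gs P n + 1 := by
  unfold gs
  rw [Finset.sum_range_succ', Finset.mul_sum]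
  simp [pow_succ, mul_comm]

lemma sg_odd (P : F4[X]) {h : ℕ} (hh : Odd h) : sg P h = gs P (h + 1) := by
  unfold sg gs expo
  rw [Finset.filter_true_of_mem]
  intro a _ h2
  rw [← h2] at hh
  exact absurd hh (by simp)

lemma sg_even (P : F4[X]) (n : ℕ) :
    sg P (2 * n) = (P + 1) * (gs P (n + 1) * gs P n) := by
  have h1 : expo (2 * n) = Finset.range n ∪ (Finset.range n).image (fun i => n + 1 + i) := by
    ext a
    simp only [mem_expo, Finset.mem_union, Finset.mem_range, Finset.mem_image]
    constructor
    · rintro ⟨h1, h2⟩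
      by_cases ha : a < n
      · exact Or.inl ha
      · exact Or.inr ⟨a - (n + 1), by omega, by omega⟩
    · rintro (h | ⟨i, hi, rfl⟩) <;> omega
  unfold sg
  rw [h1, Finset.sum_union, Finset.sum_image]
  · simp only [pow_add _ (n + 1)]
    rw [← Finset.mul_sum]
    have := gs_mul P (n + 1)
    calc _ = (P ^ (n + 1) + 1) * gs P n := by unfold gs; ring
      _ = _ := by rw [← this]; ring
  · intro x _ y _ hxy
    simp only at hxy
    omega
  · rw [Finset.disjoint_left]
    intro a ha hb
    simp only [Finset.mem_range, Finset.mem_image] at ha hb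
    obtain ⟨i, -, rfl⟩ := hb
    omega

lemma not_dvd_sg {P : F4[X]} (hP : Irreducible P) {h : ℕ} (hh : 0 < h) : ¬ P ∣ sg P h := by
  have h0 : 0 ∈ expo h := by rw [mem_expo]; omega
  unfold sg
  rw [← Finset.add_sum_erase _ _ h0, pow_zero]
  intro hd
  have : P ∣ ∑ x ∈ (expo h).erase 0, P ^ x := by
    apply Finset.dvd_sum
    intro i hi
    exact dvd_pow_self _ (Finset.ne_of_mem_erase hi)
  exact hP.not_isUnit (isUnit_of_dvd_one ((dvd_add_left this).mp hd))

lemma gs_dvd_gs {P : F4[X]} (hP : P + 1 ≠ 0) {m n : ℕ} (hmn : m ∣ n) : gs P m ∣ gs P n := by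
  have h1 : P ^ m + 1 ∣ P ^ n + 1 := by
    have := pow_one_sub_dvd_pow_mul_sub_one P m (n / m)
    rw [Nat.mul_div_cancel' hmn, CharTwo.sub_eq_add, CharTwo.sub_eq_add] at this
    exact this
  rw [← gs_mul, ← gs_mul] at h1
  exact (mul_dvd_mul_iff_right hP).mp h1

lemma add_one_dvd_gs {P : F4[X]} (hP : P + 1 ≠ 0) {n : ℕ} (hn : Even n) : P + 1 ∣ gs P n := by
  have := gs_dvd_gs hP hn.two_dvd
  simpa [gs, Finset.sum_range_succ, add_comm] using this

lemma add_one_dvd_sg {P : F4[X]} (hP : P + 1 ≠ 0) {h : ℕ} : P + 1 ∣ sg P h := by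
  rcases Nat.even_or_odd' h with ⟨n, rfl | rfl⟩
  · rw [sg_even]; exact dvd_mul_right _ _
  · rw [sg_odd _ ⟨n, rfl⟩]
    exact add_one_dvd_gs hP ⟨n + 1, by ring⟩

lemma not_dvd_gs_odd {P : F4[X]} (hP : Irreducible (P + 1)) {m : ℕ} (hm : Odd m) :
    ¬ P + 1 ∣ gs P m := by
  obtain ⟨n, rfl⟩ := hm
  rw [gs_succ']
  intro hd
  have := (add_one_dvd_gs hP.ne_zero (even_two_mul n)).mul_left P
  exact hP.not_isUnit (isUnit_of_dvd_one ((dvd_add_right this).mp hd))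

lemma not_dvd_gs {P : F4[X]} (hP : Irreducible P) {m : ℕ} (hm : 0 < m) :
    ¬ P ∣ gs P m := by
  obtain ⟨n, rfl⟩ := Nat.exists_eq_add_of_lt hm
  rw [zero_add, gs_succ']
  intro hd
  exact hP.not_isUnit (isUnit_of_dvd_one ((dvd_add_right (dvd_mul_right _ _)).mp hd))

lemma natDegree_add_one' {P : F4[X]} (hP : P.Monic) (hd : 0 < P.natDegree) :
    (P + 1).Monic ∧ (P + 1).natDegree = P.natDegree := by
  have hlt : (1 : F4[X]).degree < P.degree := by
    rw [degree_one]; exact natDegree_pos_iff_degree_pos.mp hd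
  refine ⟨hP.add_of_left hlt, ?_⟩
  rw [← C_1, natDegree_add_C]

lemma gs_monic {P : F4[X]} (hP : P.Monic) (hd : 0 < P.natDegree) {n : ℕ} (hn : 0 < n) :
    (gs P n).Monic := hP.geom_sum hd hn.ne'

lemma gs_natDegree {P : F4[X]} (hP : P.Monic) (hd : 0 < P.natDegree) {n : ℕ} (hn : 0 < n) :
    (gs P n).natDegree + P.natDegree = n * P.natDegree := by
  have h1 := congrArg natDegree (gs_mul P n)
  rw [(gs_monic hP hd hn).natDegree_mul (natDegree_add_one' hP hd).1,
    (natDegree_add_one' hP hd).2, ← C_1, natDegree_add_C, hP.natDegree_pow] at h1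
  exact h1

/-! ### Reducibility of `1 + x + ⋯ + x^(2^t)` over `F4` -/

lemma not_irreducible_gs_X (t : ℕ) (ht : 0 < t) : ¬ Irreducible (gs (X : F4[X]) (2 ^ t + 1)) := by
  intro hi
  have hcard : Nat.card F4 = 4 := by
    rw [GaloisField.card 2 2 (by norm_num)]; norm_num
  have hdeg : (gs (X : F4[X]) (2 ^ t + 1)).natDegree = 2 ^ t := by
    have := gs_natDegree (monic_X (R := F4)) (by simp) (Nat.succ_pos (2 ^ t))
    simpa using this
  have hX1 : (X : F4[X]) + 1 ≠ 0 := (natDegree_add_one' monic_X (by simp)).1.ne_zero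
  have h4 : 4 ^ t = (2 ^ t + 1) * (2 ^ t - 1) + 1 := by
    have h2 : 1 ≤ 2 ^ t := Nat.one_le_two_pow
    obtain ⟨u, hu⟩ := Nat.exists_eq_add_of_le h2
    have : (4 : ℕ) ^ t = 2 ^ t * 2 ^ t := by rw [← mul_pow]; norm_num
    rw [this, hu]
    simp
    ring
  have hd : gs (X : F4[X]) (2 ^ t + 1) ∣ X ^ (Nat.card F4) ^ t - X := by
    rw [hcard, h4, CharTwo.sub_eq_add]
    have e : (X : F4[X]) ^ ((2 ^ t + 1) * (2 ^ t - 1) + 1) + X =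
        X * (X ^ ((2 ^ t + 1) * (2 ^ t - 1)) + 1) := by ring
    rw [e, ← gs_mul]
    exact ((gs_dvd_gs hX1 (dvd_mul_right _ _)).mul_right _).mul_left _
  have h1 := hi.natDegree_dvd_of_dvd_X_pow_card_pow_sub_X hd
  rw [hdeg] at h1
  exact absurd (Nat.le_of_dvd ht h1) (not_le.mpr Nat.lt_two_pow_self)

lemma gs_comp (P : F4[X]) (n : ℕ) : (gs X n).comp P = gs P n := by
  unfold gs
  rw [← coe_compRingHom_apply, map_sum]
  simp

lemma irreducible_of_comp {f P : F4[X]} (hP : 0 < P.natDegree) (hf : Irreducible (f.comp P)) :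
    Irreducible f := by
  have key : ∀ g : F4[X], IsUnit (g.comp P) → IsUnit g := by
    intro g hg
    have h1 := natDegree_eq_zero_of_isUnit hg
    rw [natDegree_comp] at h1
    have h2 : g.natDegree = 0 := by
      rcases Nat.mul_eq_zero.mp h1 with h | h
      · exact h
      · omega
    rw [eq_C_of_natDegree_eq_zero h2] at hg ⊢
    simpa using hg
  constructor
  · intro hu
    exact hf.not_isUnit (by simpa using hu.map (compRingHom P))
  · intro a b hab
    rw [hab, mul_comp] at hf
    rcases hf.isUnit_or_isUnit rfl with h | h
    · exact Or.inl (key _ h)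
    · exact Or.inr (key _ h)

lemma not_irreducible_gs {P : F4[X]} (hd : 0 < P.natDegree) {t : ℕ} (ht : 0 < t) :
    ¬ Irreducible (gs P (2 ^ t + 1)) := by
  intro hi
  rw [← gs_comp] at hi
  exact not_irreducible_gs_X t ht (irreducible_of_comp hd hi)

/-! ### The main argument -/

lemma not_sq_dvd_gs {P R : F4[X]} (hP : Irreducible P) (hR : Irreducible R)
    (hRP : ¬ R ∣ P) (hdeg : P.natDegree ≤ R.natDegree) {m : ℕ} (hm : Odd m) :
    ¬ R * R ∣ gs P m := by
  rintro hd
  have h1 : R * R ∣ P ^ m + 1 := by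
    rw [← gs_mul]; exact hd.mul_right _
  obtain ⟨T, hT⟩ := h1
  have h2 := congrArg derivative hT
  have hm1 : ((m : ℕ) : F4[X]) = 1 := by
    obtain ⟨n, rfl⟩ := hm
    push_cast
    rw [CharTwo.two_eq_zero (R := F4[X])]; simp
  rw [derivative_add, derivative_one, add_zero, derivative_pow, map_natCast, hm1, one_mul] at h2
  have h3 : R ∣ P ^ (m - 1) * derivative P := by
    rw [h2, derivative_mul, derivative_mul]
    exact ⟨derivative R * T + derivative R * T + R * derivative T, by ring⟩
  rcases hR.prime.dvd_or_dvd h3 with h | h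
  · exact hRP (hR.prime.dvd_of_dvd_pow h)
  · have hsep : P.Separable := PerfectField.separable_of_irreducible hP
    have hne : derivative P ≠ 0 := by
      intro h0
      unfold Separable at hsep
      rw [h0, isCoprime_zero_right] at hsep
      exact hP.not_isUnit hsep
    have h4 := natDegree_le_of_dvd h hne
    have h5 := natDegree_derivative_lt hP.natDegree_pos.ne'
    omega

lemma exists_factor {f : F4[X]} (hf : ¬ IsUnit f) :
    ∃ p : F4[X], p.Monic ∧ Irreducible p ∧ p ∣ f := by
  obtain ⟨p, hp1, hp2, hp3⟩ := exists_monic_irreducible_factor f hf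
  exact ⟨p, by assumption, by assumption, by assumption⟩

lemma exists_odd_part {n : ℕ} (hn : 0 < n) : ∃ s m, Odd m ∧ n = 2 ^ s * m := by
  obtain ⟨s, m, hm, h⟩ := Nat.exists_eq_two_pow_mul_odd hn.ne'
  exact ⟨s, m, hm, h⟩

lemma core_one {P R : F4[X]} (t : Triple P (P + 1) R) {h : ℕ} (hh : 0 < h)
    (hdeg : P.natDegree ≤ R.natDegree)
    (H1 : ∀ p : F4[X], p.Monic → Irreducible p → p ∣ sg P h → p = P ∨ p = P + 1 ∨ p = R)
    (H2 : ∀ p : F4[X], p.Monic → Irreducible p → p ∣ R + 1 → p = P ∨ p = P + 1 ∨ p = R) :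
    ¬ R ∣ sg P h := by
  intro hR
  have hPd := t.Pi.natDegree_pos
  have hR1 : ¬ R ∣ P + 1 := fun hd =>
    t.QR (eq_of_monic_of_associated t.Rm t.Qm (t.Ri.associated_of_dvd t.Qi hd)).symm
  have hRP : ¬ R ∣ P := fun hd =>
    t.PR (eq_of_monic_of_associated t.Rm t.Pm (t.Ri.associated_of_dvd t.Pi hd)).symm
  obtain ⟨N, hN, hRN, hNs⟩ : ∃ N, 0 < N ∧ R ∣ gs P N ∧ gs P N ∣ sg P h := by
    rcases Nat.even_or_odd' h with ⟨n, rfl | rfl⟩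
    · rw [sg_even] at hR ⊢
      rcases t.Ri.prime.dvd_or_dvd hR with h1 | h1
      · exact absurd h1 hR1
      · rcases t.Ri.prime.dvd_or_dvd h1 with h2 | h2
        · exact ⟨n + 1, by omega, h2, (dvd_mul_right _ _).mul_left _⟩
        · exact ⟨n, by omega, h2, (dvd_mul_left _ _).mul_left _⟩
    · rw [sg_odd _ ⟨n, rfl⟩] at hR ⊢
      exact ⟨_, by omega, hR, dvd_rfl⟩
  obtain ⟨s, m, hm, rfl⟩ := exists_odd_part hN
  have hmpos : 0 < m := hm.pos
  have hmS : gs P m ∣ sg P h := (gs_dvd_gs t.Qi.ne_zero (dvd_mul_left _ _)).trans hNs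
  have hRm : R ∣ gs P m := by
    have h1 : R ∣ (P ^ m + 1) ^ 2 ^ s := by
      rw [add_pow_char_pow, one_pow, ← pow_mul, mul_comm m, ← gs_mul]
      exact hRN.mul_right _
    have h2 := t.Ri.prime.dvd_of_dvd_pow h1
    rw [← gs_mul] at h2
    exact (t.Ri.prime.dvd_or_dvd h2).resolve_right hR1
  have hEq : gs P m = R := by
    obtain ⟨T, hT⟩ := hRm
    have hTm : T.Monic := t.Rm.of_mul_monic_left (hT ▸ gs_monic t.Pm hPd hmpos)
    by_cases hu : IsUnit T
    · rw [hT, hTm.eq_one_of_isUnit hu, mul_one]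
    · exfalso
      obtain ⟨p, hpm, hpi, hpT⟩ := exists_factor hu
      have hpg : p ∣ gs P m := hT ▸ hpT.mul_left R
      rcases H1 p hpm hpi (hpg.trans hmS) with rfl | rfl | rfl
      · exact not_dvd_gs t.Pi hmpos hpg
      · exact not_dvd_gs_odd t.Qi hm hpg
      · exact not_sq_dvd_gs t.Pi t.Ri hRP hdeg hm (hT ▸ mul_dvd_mul_left p hpT)
  have hm1 : m ≠ 1 := by
    rintro rfl
    apply t.Ri.not_isUnit
    rw [← hEq]
    simp [gs]
  obtain ⟨n, rfl⟩ : ∃ n, m = n + 1 := ⟨m - 1, by omega⟩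
  obtain ⟨u, m', hm', rfl⟩ := exists_odd_part (n := n) (by omega)
  have hR1' : R + 1 = P * gs P (2 ^ u * m') := by
    rw [← hEq, gs_succ', add_assoc, CharTwo.add_self_eq_zero, add_zero]
  have hd' : gs P m' ∣ R + 1 := by
    rw [hR1']
    exact (gs_dvd_gs t.Qi.ne_zero (dvd_mul_left _ _)).mul_left _
  have hunit : IsUnit (gs P m') := by
    by_contra hu
    obtain ⟨p, hpm, hpi, hpT⟩ := exists_factor hu
    rcases H2 p hpm hpi (hpT.trans hd') with rfl | rfl | rfl
    · exact not_dvd_gs t.Pi hm'.pos hpT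
    · exact not_dvd_gs_odd t.Qi hm' hpT
    · exact t.Ri.not_isUnit (isUnit_of_dvd_one ((dvd_add_right dvd_rfl).mp (hpT.trans hd')))
  have hm'1 : m' = 1 := by
    have h1 := gs_natDegree t.Pm hPd hm'.pos
    rw [natDegree_eq_zero_of_isUnit hunit, zero_add] at h1
    nlinarith [hm'.pos]
  subst hm'1
  have hupos : 0 < u := by
    rcases Nat.eq_zero_or_pos u with rfl | hu
    · exact absurd hm (by decide)
    · exact hu
  rw [mul_one] at hEq
  exact not_irreducible_gs hPd hupos (hEq ▸ t.Ri)

lemma core {P Q R : F4[X]} (t : Triple P Q R) (hQ : Q = P + 1)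
    (hdeg : P.natDegree ≤ R.natDegree) {h k l : ℕ}
    (hh : 0 < h) (hk : 0 < k) (hl : 0 < l) :
    sg P h * (sg Q k * sg R l) ≠ P ^ h * (Q ^ k * R ^ l) := by
  intro he
  have hQP : P = Q + 1 := by
    rw [hQ, add_assoc, CharTwo.add_self_eq_zero, add_zero]
  have hdegQ : Q.natDegree = P.natDegree := by
    rw [hQ]; exact (natDegree_add_one' t.Pm t.Pi.natDegree_pos).2
  have H : ∀ p : F4[X], p.Monic → Irreducible p → p ∣ sg P h * (sg Q k * sg R l) →
      p = P ∨ p = Q ∨ p = R := by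
    intro p hpm hpi hd
    rw [he] at hd
    exact t.irr_dvd hpi hpm hd
  have hR1 : R + 1 ≠ 0 := (natDegree_add_one' t.Rm t.Ri.natDegree_pos).1.ne_zero
  have H2 : ∀ p : F4[X], p.Monic → Irreducible p → p ∣ R + 1 → p = P ∨ p = Q ∨ p = R :=
    fun p hpm hpi hd => H p hpm hpi (((hd.trans (add_one_dvd_sg hR1)).mul_left _).mul_left _)
  have hRd : R ∣ sg P h * (sg Q k * sg R l) := by
    rw [he]
    exact ((dvd_pow_self _ hl.ne').mul_left _).mul_left _
  rcases t.Ri.prime.dvd_or_dvd hRd with h1 | h1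
  · subst hQ
    exact core_one t hh hdeg (fun p hpm hpi hd => H p hpm hpi (hd.mul_right _)) H2 h1
  · rcases t.Ri.prime.dvd_or_dvd h1 with h2 | h2
    · have t' : Triple Q (Q + 1) R := by
        rw [← hQP]
        exact ⟨t.Qm, t.Pm, t.Rm, t.Qi, t.Pi, t.Ri, t.PQ.symm, t.QR, t.PR⟩
      refine core_one t' hk (hdegQ.trans_le hdeg) ?_ ?_ h2
      · intro p hpm hpi hd
        rw [← hQP]
        have := H p hpm hpi ((hd.mul_right _).mul_left _)
        tauto
      · intro p hpm hpi hd
        rw [← hQP]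
        have := H2 p hpm hpi hd
        tauto
    · exact not_dvd_sg t.Ri hl h2

theorem stmt13 (P Q R : F4[X]) (hPm : P.Monic) (hQm : Q.Monic) (hRm : R.Monic)
    (hPi : Irreducible P) (hQi : Irreducible Q) (hRi : Irreducible R)
    (hPQ : P ≠ Q) (hPR : P ≠ R) (hQR : Q ≠ R)
    (hdeg1 : P.natDegree ≤ Q.natDegree) (hdeg2 : Q.natDegree ≤ R.natDegree)
    (h k l : ℕ) (hh : 0 < h) (hk : 0 < k) (hl : 0 < l)
    (hnotallodd : ¬ (Odd h ∧ Odd k ∧ Odd l)) :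
    ¬ IsBUPerfect (P ^ h * Q ^ k * R ^ l) := by
  intro hperf
  have t : Triple P Q R := ⟨hPm, hQm, hRm, hPi, hQi, hRi, hPQ, hPR, hQR⟩
  unfold IsBUPerfect at hperf
  rw [mul_assoc, t.sigmaBU_eq hh hk hl] at hperf
  obtain ⟨hP1m, hP1d⟩ := natDegree_add_one' hPm hPi.natDegree_pos
  have hnu : ¬ IsUnit (P + 1) := by
    intro hu
    have := natDegree_eq_zero_of_isUnit hu
    have := hPi.natDegree_pos
    omega
  obtain ⟨p, hpm, hpi, hpd⟩ := exists_factor hnu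
  have hcase := t.irr_dvd hpi hpm
    (hperf ▸ (hpd.trans (add_one_dvd_sg hP1m.ne_zero)).mul_right _)
  have key : P.natDegree ≤ p.natDegree → p = P + 1 := by
    intro hle
    exact (eq_of_monic_of_dvd_of_natDegree_le hpm hP1m hpd (by omega)).symm
  rcases hcase with rfl | rfl | rfl
  · exact hpi.not_isUnit (isUnit_of_dvd_one ((dvd_add_right dvd_rfl).mp hpd))
  · exact core t (key hdeg1) (hdeg1.trans hdeg2) hh hk hl hperf
  · have t' : Triple P p Q := ⟨hPm, hRm, hQm, hPi, hRi, hQi, hPR, hPQ, hQR.symm⟩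
    refine core t' (key (hdeg1.trans hdeg2)) hdeg1 hh hl hk ?_
    rw [mul_comm (sg p l), hperf, mul_comm (Q ^ k)]
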